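/- arXiv:2207.14544 — 2 statements merged into one kernel-verified Lean document; each statement's English description precedes it below -/
import Mathlib

section
/- For all integers m, n > 0 and every integer r with 0 ≤ r ≤ n−1, the number of paths P ∈ D⁺(m,n,1) with val(P) = r satisfies n · #{P ∈ D⁺(m,n,1) : val(P) = r} = C(n, r+1)·C(mn−2, r), as an identity of integers. -/
/-- A step of a lattice path: north `(0,1)`, east `(1,0)` or diagonal `(1,1)`. -/
inductive Step : Type
  | N : Step
  | E : Step
  | D : Step
  deriving DecidableEq

/-- The displacement vector of a step. -/
def stepVec : Step → ℤ × ℤ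
  | .N => (0, 1)
  | .E => (1, 0)
  | .D => (1, 1)

/-- The lattice point reached after the first `k` steps of the path `P` (starting at the
origin). -/
def pt (P : List Step) (k : ℕ) : ℤ × ℤ := ((P.take k).map stepVec).sum

/-- The path `P` starts with at least `t` north steps. -/
def StartsNorth (t : ℤ) (P : List Step) : Prop := List.replicate t.toNat Step.N <+: P

/-- The path `P` stays weakly above the line `x = m·y`. -/
def AboveLine (m : ℤ) (P : List Step) : Prop := ∀ k : ℕ, (pt P k).1 ≤ m * (pt P k).2

/-- An `(m,t)`-Schröder path of height `n`: a lattice path from `(0,0)` to `(mn,n)` using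
north, east and diagonal steps, starting with at least `t` north steps and never going
below the line `x = m·y`. -/
def IsSchroeder (m n t : ℤ) (P : List Step) : Prop :=
  StartsNorth t P ∧ pt P P.length = (m * n, n) ∧ AboveLine m P

/-- An `(m,t)`-Dyck path of height `n`: an `(m,t)`-Schröder path of height `n` with no
diagonal steps. -/
def IsDyck (m n t : ℤ) (P : List Step) : Prop :=
  IsSchroeder m n t P ∧ ∀ s ∈ P, s ≠ Step.D

/-- A Schröder path is small if none of its diagonal steps starts on the line `x = m·y`. -/
def IsSmall (m : ℤ) (P : List Step) : Prop :=
  ∀ j : ℕ, P[j]? = some Step.D → (pt P j).1 ≠ m * (pt P j).2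

/-- A Schröder path is positive if it touches the line `x = m·y` only at its two
endpoints. -/
def IsPositive (m : ℤ) (P : List Step) : Prop :=
  ∀ k : ℕ, 0 < k → k < P.length → (pt P k).1 ≠ m * (pt P k).2

/-- The set of indices `j` such that the `j`-th step of `P` is east and the `(j+1)`-st is
north; the corresponding valley point is `pt P (j+1)`. -/
def valleys (P : List Step) : Finset ℕ :=
  (Finset.range P.length).filter fun j => P[j]? = some Step.E ∧ P[j + 1]? = some Step.N

/-- The number of valleys of `P`. -/
def val (P : List Step) : ℕ := (valleys P).card

/-- The number of valleys of `P` whose `x`-coordinate is congruent to `i` modulo `m`. -/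
def ival (m i : ℤ) (P : List Step) : ℕ :=
  ((valleys P).filter fun j => (pt P (j + 1)).1 % m = i % m).card

/-- The set of returns of `P`: valleys of the form `(m·i, i)`. -/
def returns (m : ℤ) (P : List Step) : Finset ℕ :=
  (valleys P).filter fun j => (pt P (j + 1)).1 = m * (pt P (j + 1)).2

/-- The number of returns of `P`. -/
def ret (m : ℤ) (P : List Step) : ℕ := (returns m P).card

/-- The set of indices of diagonal steps of `P`. -/
def diags (P : List Step) : Finset ℕ :=
  (Finset.range P.length).filter fun j => P[j]? = some Step.D

/-- The number of diagonal steps of `P`. -/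
def dg (P : List Step) : ℕ := (diags P).card

/-- A Schröder path is `m`-divisible if every diagonal step ends at an `x`-coordinate
divisible by `m`. -/
def MDivisible (m : ℤ) (P : List Step) : Prop :=
  ∀ j ∈ diags P, m ∣ (pt P (j + 1)).1

/-- The number of cornered diagonal steps of `P`: diagonal steps connecting `(i·m − 1, i)`
to `(i·m, i + 1)` for some `i`. -/
def cd (m : ℤ) (P : List Step) : ℕ :=
  ((diags P).filter fun j => (pt P (j + 1)).1 = m * ((pt P (j + 1)).2 - 1)).card

/-- The generalized binomial coefficient `C(p,q) = p(p−1)⋯(p−q+1)/q!` for integers `p` and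
`q ≥ 0`, and `C(p,q) = 0` for `q < 0`. -/
def C (p q : ℤ) : ℤ :=
  if q < 0 then 0
  else if 0 ≤ p then (p.toNat.choose q.toNat : ℤ)
  else (-1) ^ q.toNat * ((q - p - 1).toNat.choose q.toNat : ℤ)

/-- The change of the height `m·y - x` along a step. -/
def rise (m : ℤ) (s : Step) : ℤ := m * (stepVec s).2 - (stepVec s).1

/-- The height `m·y - x` of the endpoint of a path. -/
def height (m : ℤ) (P : List Step) : ℤ := (P.map (rise m)).sum

lemma height_take (m : ℤ) (P : List Step) (k : ℕ) :
    height m (P.take k) = m * (pt P k).2 - (pt P k).1 := by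
  unfold height pt
  generalize P.take k = Q
  induction Q with
  | nil => simp
  | cons s Q ih => simp [ih, rise]; ring

lemma height_append (m : ℤ) (P Q : List Step) :
    height m (P ++ Q) = height m P + height m Q := by
  simp [height]

/-- A path starting at height `h` has nonnegative heights and no valley of height `0`. -/
def StaysAbove (m : ℤ) : ℤ → List Step → Prop
  | h, [] => 0 ≤ h
  | h, s :: P => 0 ≤ h ∧ (s = Step.E → P.head? = some Step.N → h ≠ 1) ∧
      StaysAbove m (h + rise m s) P

lemma StaysAbove.nonneg {m h : ℤ} {P : List Step} (H : StaysAbove m h P) : 0 ≤ h := by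
  cases P with
  | nil => exact H
  | cons s P => exact H.1

lemma staysAbove_iff (m h : ℤ) (P : List Step) :
    StaysAbove m h P ↔ (∀ k : ℕ, 0 ≤ h + height m (P.take k)) ∧
      ∀ j : ℕ, P[j]? = some Step.E → P[j + 1]? = some Step.N →
        h + height m (P.take (j + 1)) ≠ 0 := by
  induction P generalizing h with
  | nil => simp [StaysAbove, height]
  | cons s P ih =>
    rw [StaysAbove, ih]
    constructor
    · rintro ⟨h0, h1, h2, h3⟩
      refine ⟨fun k => ?_, fun j hj hj' => ?_⟩
      · cases k with
        | zero => simpa [height] using h0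
        | succ k => simpa [height, add_assoc] using h2 k
      · cases j with
        | zero =>
          simp only [List.getElem?_cons_zero, Option.some.injEq] at hj
          subst hj
          have := h1 rfl (by simpa [List.head?_eq_getElem?] using hj')
          simp [height, rise, stepVec]
          omega
        | succ j => simpa [height, add_assoc] using h3 j (by simpa using hj) (by simpa using hj')
    · rintro ⟨h0, h1⟩
      refine ⟨by simpa [height] using h0 0, ?_, fun k => ?_, fun j hj hj' => ?_⟩
      · rintro rfl hP rfl
        exact h1 0 (by simp) (by simpa [List.head?_eq_getElem?] using hP)
          (by simp [height, rise, stepVec])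
      · simpa [height, add_assoc] using h0 (k + 1)
      · simpa [height, add_assoc] using h1 (j + 1) (by simpa using hj) (by simpa using hj')

lemma aboveLine_and_ret_eq_zero_iff (m : ℤ) (P : List Step) :
    AboveLine m P ∧ ret m P = 0 ↔ StaysAbove m 0 P := by
  rw [staysAbove_iff]
  refine and_congr (forall_congr' fun k => ?_) ?_
  · rw [height_take]; omega
  · rw [ret, returns, Finset.card_eq_zero, Finset.filter_eq_empty_iff]
    simp only [valleys, Finset.mem_filter, Finset.mem_range, height_take]
    refine ⟨fun H j hj hj' => ?_, fun H j hj => ?_⟩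
    · have := @H j ⟨(List.getElem?_eq_some_iff.1 hj).1, hj, hj'⟩
      omega
    · have := H j hj.2.1 hj.2.2
      omega

lemma val_cons (s : Step) (P : List Step) :
    val (s :: P) = val P + if s = Step.E ∧ P.head? = some Step.N then 1 else 0 := by
  simp only [val, valleys, Finset.card_filter, List.length_cons]
  rw [Finset.sum_range_succ']
  simp [List.head?_eq_getElem?]

/-- The path `N^(p.1 + 1) E^(p.2 + 1)`. -/
def block (p : ℕ × ℕ) : List Step :=
  List.replicate (p.1 + 1) Step.N ++ List.replicate (p.2 + 1) Step.E

/-- The concatenation of the blocks of a list. -/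
def blocks (L : List (ℕ × ℕ)) : List Step := L.flatMap block

/-- The total rise along a block. -/
def blockRise (m : ℤ) (p : ℕ × ℕ) : ℤ := m * (p.1 + 1) - (p.2 + 1)

lemma blocks_cons (p : ℕ × ℕ) (L : List (ℕ × ℕ)) : blocks (p :: L) = block p ++ blocks L := rfl

lemma head?_blocks_append {L : List (ℕ × ℕ)} (hL : L ≠ []) (R : List Step) :
    (blocks L ++ R).head? = some Step.N := by
  cases L with
  | nil => exact absurd rfl hL
  | cons p L => simp [blocks_cons, block, List.replicate_succ]

lemma sum_stepVec_blocks (L : List (ℕ × ℕ)) :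
    ((blocks L).map stepVec).sum =
      (((L.map fun p => (p.2 + 1 : ℤ)).sum), ((L.map fun p => (p.1 + 1 : ℤ)).sum)) := by
  induction L with
  | nil => rfl
  | cons p L ih =>
    rw [blocks_cons, List.map_append, List.sum_append, ih]
    ext <;> simp [block, stepVec]

lemma height_blocks (m : ℤ) (L : List (ℕ × ℕ)) :
    height m (blocks L) = (L.map (blockRise m)).sum := by
  induction L with
  | nil => rfl
  | cons p L ih =>
    rw [blocks_cons, height_append, ih, List.map_cons, List.sum_cons]
    simp [height, block, rise, stepVec, blockRise]
    ring

lemma val_replicate_N_append (a : ℕ) (R : List Step) :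
    val (List.replicate a Step.N ++ R) = val R := by
  induction a with
  | zero => rfl
  | succ a ih => simp [List.replicate_succ, val_cons, ih]

lemma val_replicate_E_append (b : ℕ) (R : List Step) :
    val (List.replicate (b + 1) Step.E ++ R) =
      val R + if R.head? = some Step.N then 1 else 0 := by
  induction b with
  | zero => simp [List.replicate_succ, val_cons]
  | succ b ih =>
    rw [List.replicate_succ, List.cons_append, val_cons, ih]
    simp [List.replicate_succ]

lemma val_blocks (p : ℕ × ℕ) (L : List (ℕ × ℕ)) :
    val (blocks (p :: L) ++ [Step.E]) = L.length := by
  induction L generalizing p with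
  | nil =>
    rw [blocks_cons, block, List.append_assoc, List.append_assoc, val_replicate_N_append,
      val_replicate_E_append]
    decide
  | cons q L ih =>
    rw [blocks_cons, block, List.append_assoc, List.append_assoc, val_replicate_N_append,
      val_replicate_E_append, ih, head?_blocks_append (List.cons_ne_nil q L)]
    simp

lemma staysAbove_replicate_N_append {m : ℤ} (hm : 0 < m) (h : ℤ) (a : ℕ) (R : List Step) :
    StaysAbove m h (List.replicate a Step.N ++ R) ↔ 0 ≤ h ∧ StaysAbove m (h + m * a) R := by
  induction a generalizing h with
  | zero => simpa using fun H => StaysAbove.nonneg H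
  | succ a ih =>
    rw [List.replicate_succ, List.cons_append, StaysAbove, ih]
    have : h + rise m Step.N + m * a = h + m * (a + 1 : ℕ) := by
      simp [rise, stepVec]; ring
    rw [this]
    simp [rise, stepVec]
    intro h0 _
    omega

lemma staysAbove_replicate_E_append (m h : ℤ) (b : ℕ) {R : List Step}
    (hR : R.head? = some Step.N ∨ R = [Step.E]) :
    StaysAbove m h (List.replicate (b + 1) Step.E ++ R) ↔
      1 ≤ h - (b + 1) ∧ StaysAbove m (h - (b + 1)) R := by
  induction b generalizing h with
  | zero =>
    have : h + rise m Step.E = h - 1 := by simp [rise, stepVec]; ring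
    simp only [List.replicate_succ, List.replicate_zero, List.cons_append, List.nil_append,
      StaysAbove, this, Nat.cast_zero, zero_add, true_imp_iff]
    constructor
    · rintro ⟨h0, h1, h2⟩
      refine ⟨?_, h2⟩
      have h3 := h2.nonneg
      rcases hR with hR | rfl
      · have := h1 hR
        omega
      · have := h2.2.2
        simp [StaysAbove, rise, stepVec] at this
        omega
    · rintro ⟨h0, h1⟩
      exact ⟨by omega, fun _ => by omega, h1⟩
  | succ b ih =>
    have h1 : h + rise m Step.E - (b + 1) = h - ((b + 1 : ℕ) + 1) := by
      simp [rise, stepVec]; ring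
    rw [List.replicate_succ, List.cons_append, StaysAbove, ih, h1]
    simp [List.replicate_succ]
    intro _ _
    omega

lemma staysAbove_block_append {m : ℤ} (hm : 0 < m) (h : ℤ) (p : ℕ × ℕ) {R : List Step}
    (hR : R.head? = some Step.N ∨ R = [Step.E]) :
    StaysAbove m h (block p ++ R) ↔
      0 ≤ h ∧ 1 ≤ h + blockRise m p ∧ StaysAbove m (h + blockRise m p) R := by
  rw [block, List.append_assoc, staysAbove_replicate_N_append hm,
    staysAbove_replicate_E_append _ _ _ hR]
  have : h + m * (p.1 + 1 : ℕ) - (p.2 + 1) = h + blockRise m p := by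
    simp [blockRise]; ring
  rw [this]

lemma staysAbove_blocks_append {m : ℤ} (hm : 0 < m) (h : ℤ) (hh : 0 ≤ h) (L : List (ℕ × ℕ))
    {R : List Step} (hR : R.head? = some Step.N ∨ R = [Step.E]) :
    StaysAbove m h (blocks L ++ R) ↔
      (∀ j < L.length, 1 ≤ h + ((L.map (blockRise m)).take (j + 1)).sum) ∧
        StaysAbove m (h + (L.map (blockRise m)).sum) R := by
  induction L generalizing h with
  | nil => simp [blocks]
  | cons p L ih =>
    have hR' : (blocks L ++ R).head? = some Step.N ∨ blocks L ++ R = [Step.E] := by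
      rcases eq_or_ne L [] with rfl | hL
      · exact hR
      · exact Or.inl (head?_blocks_append hL R)
    rw [blocks_cons, List.append_assoc, staysAbove_block_append hm _ _ hR']
    constructor
    · rintro ⟨-, h1, h2⟩
      obtain ⟨h3, h4⟩ := (ih _ (by omega)).1 h2
      refine ⟨fun j hj => ?_, by simpa [add_assoc] using h4⟩
      cases j with
      | zero => simpa using h1
      | succ j => simpa [add_assoc] using h3 j (by simpa using hj)
    · rintro ⟨h1, h2⟩
      have h3 : 1 ≤ h + blockRise m p := by simpa using h1 0 (by simp)
      refine ⟨hh, h3, (ih _ (by omega)).2 ⟨fun j hj => ?_, by simpa [add_assoc] using h2⟩⟩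
      simpa [add_assoc] using h1 (j + 1) (by simpa using hj)

/-- The number of leading east steps of a path, and the blocks following them. -/
def readBlocks : List Step → ℕ × List (ℕ × ℕ)
  | [] => (0, [])
  | Step.N :: P =>
    match readBlocks P with
    | (0, []) => (0, [])
    | (0, p :: L) => (0, (p.1 + 1, p.2) :: L)
    | (b + 1, L) => (0, (0, b) :: L)
  | _ :: P => ((readBlocks P).1 + 1, (readBlocks P).2)

lemma readBlocks_blocks (L : List (ℕ × ℕ)) : readBlocks (blocks L) = (0, L) := by
  induction L with
  | nil => rfl
  | cons p L ih =>
    obtain ⟨a, b⟩ := p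
    have hE (k : ℕ) : readBlocks (List.replicate k Step.E ++ blocks L) = (k, L) := by
      induction k with
      | zero => exact ih
      | succ k ihk => simp [List.replicate_succ, readBlocks, ihk]
    rw [blocks_cons, block, List.append_assoc]
    induction a with
    | zero => simp [readBlocks, hE (b + 1)]
    | succ a iha =>
      rw [List.replicate_succ, List.cons_append, readBlocks, iha]

lemma blocks_injective : Function.Injective blocks := fun L L' h => by
  have := congrArg readBlocks h
  rw [readBlocks_blocks, readBlocks_blocks] at this
  exact (Prod.mk.inj this).2

lemma exists_eq_blocks (P : List Step) (hP : ∀ s ∈ P, s ≠ Step.D) :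
    ∃ c L d, P = List.replicate c Step.E ++ (blocks L ++ List.replicate d Step.N) := by
  induction P with
  | nil => exact ⟨0, [], 0, rfl⟩
  | cons s P ih =>
    obtain ⟨c, L, d, rfl⟩ := ih fun s hs => hP s (List.mem_cons_of_mem _ hs)
    cases s with
    | D => exact absurd rfl (hP _ List.mem_cons_self)
    | E => exact ⟨c + 1, L, d, rfl⟩
    | N =>
      cases c with
      | zero =>
        cases L with
        | nil => exact ⟨0, [], d + 1, rfl⟩
        | cons p L => exact ⟨0, (p.1 + 1, p.2) :: L, d, rfl⟩
      | succ b => exact ⟨0, (0, b) :: L, d, by simp [blocks_cons, block]⟩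

lemma isDyck_and_ret_eq_zero_iff {m n : ℤ} (hm : 0 < m) (hmn : 2 ≤ m * n) (P : List Step) :
    IsDyck m n 1 P ∧ ret m P = 0 ↔ ∃ L ≠ [], P = blocks L ++ [Step.E] ∧
      (L.map fun p => (p.2 + 1 : ℤ)).sum + 1 = m * n ∧
      (L.map fun p => (p.1 + 1 : ℤ)).sum = n ∧
      ∀ j < L.length, 1 ≤ ((L.map (blockRise m)).take (j + 1)).sum := by
  constructor
  · rintro ⟨⟨⟨hN, hend, habove⟩, hD⟩, hret⟩
    have hS := (aboveLine_and_ret_eq_zero_iff m P).1 ⟨habove, hret⟩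
    have hpre (Q R : List Step) (h : P = Q ++ R) : 0 ≤ height m Q := by
      have := ((staysAbove_iff m 0 P).1 hS).1 Q.length
      simpa [h] using this
    have hht : height m P = 0 := by
      have := height_take m P P.length
      rw [List.take_length, hend] at this
      simpa using this
    have hhead : P.head? = some Step.N := by
      obtain ⟨R, rfl⟩ := hN
      rfl
    rw [pt, List.take_length] at hend
    rcases List.eq_nil_or_concat' P with rfl | ⟨Q, s, rfl⟩
    · simp at hhead
    obtain rfl : s = Step.E := by
      cases s with
      | E => rfl
      | D => exact absurd rfl (hD Step.D (by simp))
      | N =>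
        have h1 := hpre Q [Step.N] rfl
        rw [height_append] at hht
        simp [height, rise, stepVec] at hht h1
        omega
    obtain ⟨c, L, d, rfl⟩ := exists_eq_blocks Q fun s hs => hD s (by simp [hs])
    obtain rfl : c = 0 := by
      cases c with
      | zero => rfl
      | succ c => simp [List.replicate_succ] at hhead
    simp only [List.replicate_zero, List.nil_append, List.append_assoc] at *
    have hL := hpre (blocks L) _ rfl
    have hd : d = 0 := by
      by_contra hd
      have h1 : height m (blocks L) + d * m = 1 := by
        rw [height_append, height_append] at hht
        simp [height, rise, stepVec] at hht ⊢
        omega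
      have h2 : (1 : ℤ) ≤ d := by omega
      have h3 : d * m ≤ 1 := by omega
      have hR : (List.replicate d Step.N ++ [Step.E]).head? = some Step.N := by
        obtain ⟨e, rfl⟩ := Nat.exists_eq_succ_of_ne_zero hd
        simp [List.replicate_succ]
      have h4 := ((staysAbove_blocks_append hm 0 le_rfl L (Or.inl hR)).1 hS).1
      rcases eq_or_ne L [] with rfl | hne
      · simp [blocks, stepVec] at hend
        omega
      · have h5 := h4 (L.length - 1) (by have := List.length_pos_of_ne_nil hne; omega)
        rw [Nat.sub_add_cancel (List.length_pos_of_ne_nil hne), List.take_of_length_le (by simp),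
          ← height_blocks] at h5
        nlinarith
    subst hd
    simp only [List.replicate_zero, List.nil_append] at *
    refine ⟨L, ?_, rfl, ?_⟩
    · rintro rfl
      simp [blocks] at hhead
    · rw [List.map_append, List.sum_append, sum_stepVec_blocks] at hend
      simp only [stepVec, List.map_cons, List.map_nil, List.sum_cons, List.sum_nil, add_zero,
        Prod.mk_add_mk, Prod.mk.injEq] at hend
      have := ((staysAbove_blocks_append hm 0 le_rfl L (Or.inr rfl)).1 hS).1
      exact ⟨hend.1, hend.2, by simpa using this⟩
  · rintro ⟨L, hL, rfl, hE, hN, hpos⟩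
    have hsum : ((blocks L ++ [Step.E]).map stepVec).sum = (m * n, n) := by
      rw [List.map_append, List.sum_append, sum_stepVec_blocks, hN, ← hE]
      simp [stepVec]
    have hS : StaysAbove m 0 (blocks L ++ [Step.E]) := by
      rw [staysAbove_blocks_append hm 0 le_rfl L (Or.inr rfl)]
      refine ⟨by simpa using hpos, ?_⟩
      have h := hpos (L.length - 1) (by have := List.length_pos_of_ne_nil hL; omega)
      rw [Nat.sub_add_cancel (List.length_pos_of_ne_nil hL),
        List.take_of_length_le (by simp)] at h
      simp [StaysAbove, rise, stepVec]
      omega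
    rw [← aboveLine_and_ret_eq_zero_iff] at hS
    refine ⟨⟨⟨?_, by rwa [pt, List.take_length], hS.1⟩, fun s hs => ?_⟩, hS.2⟩
    · cases L with
      | nil => exact absurd rfl hL
      | cons p L => simp [StartsNorth, blocks_cons, block, List.replicate_succ]
    · rintro rfl
      simp [blocks, block] at hs

lemma sum_range_natCast {r : ℕ} {M : Type*} [AddCommMonoid M] (y : ZMod (r + 1) → M) :
    ∑ t ∈ Finset.range (r + 1), y t = ∑ z, y z :=
  Finset.sum_nbij' (fun t => (t : ZMod (r + 1))) ZMod.val (by simp)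
    (fun z _ => Finset.mem_range.2 (ZMod.val_lt z))
    (fun t ht => ZMod.val_cast_of_lt (Finset.mem_range.1 ht)) (by simp) (by simp)

/-- The cycle lemma: exactly one rotation of a cyclic sequence of integers with sum `1` has
only positive partial sums. -/
lemma existsUnique_rotation_pos {r : ℕ} (x : ZMod (r + 1) → ℤ) (hx : ∑ z, x z = 1) :
    ∃! i : ZMod (r + 1), ∀ j < r + 1, 1 ≤ ∑ t ∈ Finset.range (j + 1), x (i + t) := by
  set S : ℕ → ℤ := fun j => ∑ t ∈ Finset.range j, x t
  have hadd (a b : ℕ) : S (a + b) = S a + ∑ t ∈ Finset.range b, x (a + t) := by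
    simp [S, Finset.sum_range_add]
  have hper (a : ℕ) : S (a + (r + 1)) = S a + 1 := by
    rw [hadd, sum_range_natCast (fun z : ZMod (r + 1) => x (a + z)), ← hx]
    exact congrArg _ (Equiv.sum_comp (Equiv.addLeft (a : ZMod (r + 1))) x)
  obtain ⟨i, hi, hmin⟩ := Finset.exists_min_image (Finset.range (r + 1))
    (fun i => (r + 1 : ℤ) * S i - i) ⟨0, by simp⟩
  simp only [Finset.mem_range] at hi hmin
  refine ⟨i, fun j hj => ?_, fun k hk => ?_⟩
  · have h1 := hadd i (j + 1)
    suffices S i < S (i + (j + 1)) by omega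
    rcases lt_or_ge (i + (j + 1)) (r + 1) with h | h
    · have h2 := hmin _ h
      push_cast at h2
      by_contra h3
      nlinarith
    · obtain ⟨l, hl⟩ := Nat.exists_eq_add_of_le' h
      rw [hl, hper]
      have h2 := hmin l (by omega)
      have h4 : (l : ℤ) ≤ i := by omega
      have h5 : (i : ℤ) < r + 1 := by omega
      by_contra h3
      have h6 : S l ≤ S i - 1 := by omega
      nlinarith
  · have hkv : ((k.val : ℕ) : ZMod (r + 1)) = k := ZMod.natCast_zmod_val k
    have hk' := ZMod.val_lt k
    have hkS (j : ℕ) (hj : j < r + 1) : S k.val < S (k.val + (j + 1)) := by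
      have h1 := hadd k.val (j + 1)
      rw [hkv] at h1
      have := hk j hj
      omega
    have hmk := hmin _ hk'
    rcases lt_trichotomy k.val i with h | h | h
    · have h1 := hkS (i - k.val - 1) (by omega)
      rw [show k.val + (i - k.val - 1 + 1) = i by omega] at h1
      have h2 : (i : ℤ) < r + 1 := by omega
      have h3 : (0 : ℤ) ≤ k.val := by omega
      nlinarith
    · rw [← hkv, h]
    · have h1 := hkS (i + (r + 1) - k.val - 1) (by omega)
      rw [show k.val + (i + (r + 1) - k.val - 1 + 1) = i + (r + 1) by omega, hper] at h1
      have h2 : (i : ℤ) < k.val := by omega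
      have h3 : (k.val : ℤ) < r + 1 := by omega
      have h4 : S k.val ≤ S i := by omega
      nlinarith

/-- The cyclic sequences `f` of length `r + 1` for which the numbers `f z + 1` sum to `N + 1`. -/
def cyclicCompositions (r N : ℕ) : Finset (ZMod (r + 1) → ℕ) :=
  if r ≤ N then Finset.piAntidiag Finset.univ (N - r) else ∅

lemma mem_cyclicCompositions {r N : ℕ} {f : ZMod (r + 1) → ℕ} :
    f ∈ cyclicCompositions r N ↔ ∑ z, f z + r = N := by
  unfold cyclicCompositions
  split_ifs with h
  · simp only [Finset.mem_piAntidiag, Finset.mem_univ, implies_true, and_true]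
    change ∑ z, f z = N - r ↔ _
    omega
  · simp only [Finset.notMem_empty, false_iff]
    omega

lemma card_cyclicCompositions (r N : ℕ) : (cyclicCompositions r N).card = N.choose r := by
  unfold cyclicCompositions
  split_ifs with h
  · have e := (Equiv.subtypeEquivRight fun f : ZMod (r + 1) → ℕ => show
      f ∈ Finset.piAntidiag Finset.univ (N - r) ↔ ∑ z, f z = N - r by simp).trans
        (Sym.equivNatSumOfFintype (ZMod (r + 1)) (N - r)).symm
    rw [Finset.card_eq_of_equiv_fintype e, Sym.card_sym_eq_choose, ZMod.card,
      show r + 1 + (N - r) - 1 = N by omega, Nat.choose_symm h]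
  · rw [Finset.card_empty, Nat.choose_eq_zero_of_lt (by omega)]

/-- The pairs of cyclic sequences whose associated block rises have positive partial sums. -/
def positivePairs (m : ℤ) (r N M : ℕ) : Finset ((ZMod (r + 1) → ℕ) × (ZMod (r + 1) → ℕ)) :=
  (cyclicCompositions r N ×ˢ cyclicCompositions r M).filter fun q =>
    ∀ j < r + 1, 1 ≤ ∑ t ∈ Finset.range (j + 1), blockRise m (q.1 t, q.2 t)

lemma rotate_mem_cyclicCompositions {r N : ℕ} {f : ZMod (r + 1) → ℕ} (i : ZMod (r + 1)) :
    (fun z => f (i + z)) ∈ cyclicCompositions r N ↔ f ∈ cyclicCompositions r N := by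
  have : ∑ z, f (i + z) = ∑ z, f z := Equiv.sum_comp (Equiv.addLeft i) f
  rw [mem_cyclicCompositions, mem_cyclicCompositions, this]

lemma card_positivePairs (m : ℤ) (r N M : ℕ) (h : m * (N + 1) - (M + 1) = 1) :
    (r + 1) * (positivePairs m r N M).card = N.choose r * M.choose r := by
  classical
  set T := cyclicCompositions r N ×ˢ cyclicCompositions r M with hT
  have hcard : T.card = N.choose r * M.choose r := by
    rw [hT, Finset.card_product, card_cyclicCompositions, card_cyclicCompositions]
  let p (q : (ZMod (r + 1) → ℕ) × (ZMod (r + 1) → ℕ)) (i : ZMod (r + 1)) : Prop :=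
    ∀ j < r + 1, 1 ≤ ∑ t ∈ Finset.range (j + 1), blockRise m (q.1 (i + t), q.2 (i + t))
  have hone : ∀ q ∈ T, (Finset.univ.filter fun i => p q i).card = 1 := by
    intro q hq
    rw [hT, Finset.mem_product, mem_cyclicCompositions, mem_cyclicCompositions] at hq
    have h1 : ∑ z, (q.1 z : ℤ) + r = N := by exact_mod_cast hq.1
    have h2 : ∑ z, (q.2 z : ℤ) + r = M := by exact_mod_cast hq.2
    obtain ⟨i, hi, huniq⟩ := existsUnique_rotation_pos (fun z => blockRise m (q.1 z, q.2 z)) (by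
      simp only [blockRise, Finset.sum_sub_distrib, ← Finset.mul_sum, Finset.sum_add_distrib]
      simp
      linear_combination h + m * h1 - h2)
    rw [Finset.card_eq_one]
    exact ⟨i, Finset.ext fun k => by
      simpa using ⟨fun hk => huniq k hk, fun hk => hk ▸ hi⟩⟩
  have hrot (i : ZMod (r + 1)) :
      (T.filter fun q => p q i).card = (positivePairs m r N M).card := by
    refine Finset.card_nbij' (fun q => (fun z => q.1 (i + z), fun z => q.2 (i + z)))
      (fun q => (fun z => q.1 (-i + z), fun z => q.2 (-i + z))) ?_ ?_ ?_ ?_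
    · intro q hq
      simpa [positivePairs, p, hT, rotate_mem_cyclicCompositions] using hq
    · intro q hq
      simpa [positivePairs, p, hT, rotate_mem_cyclicCompositions] using hq
    · intro q _
      simp
    · intro q _
      simp
  have key := Finset.sum_card_bipartiteAbove_eq_sum_card_bipartiteBelow (s := T)
    (t := (Finset.univ : Finset (ZMod (r + 1)))) p
  simp only [Finset.bipartiteAbove, Finset.bipartiteBelow] at key
  rw [Finset.sum_congr rfl hone, Finset.sum_congr rfl fun i _ => hrot i] at key
  simp [ZMod.card] at key
  rw [← hcard, ← key]

/-- The list of pairs of entries of two cyclic sequences. -/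
def pairList {r : ℕ} (q : (ZMod (r + 1) → ℕ) × (ZMod (r + 1) → ℕ)) : List (ℕ × ℕ) :=
  (List.range (r + 1)).map fun t : ℕ => (q.1 t, q.2 t)

lemma pairList_injective {r : ℕ} : Function.Injective (pairList (r := r)) := by
  intro q q' h
  have h1 (z : ZMod (r + 1)) : (q.1 z, q.2 z) = (q'.1 z, q'.2 z) := by
    have := List.map_inj_left.1 h z.val (List.mem_range.2 (ZMod.val_lt z))
    simpa using this
  ext z
  · exact congrArg Prod.fst (h1 z)
  · exact congrArg Prod.snd (h1 z)

lemma exists_pairList {r : ℕ} {L : List (ℕ × ℕ)} (hL : L.length = r + 1) :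
    ∃ q : (ZMod (r + 1) → ℕ) × (ZMod (r + 1) → ℕ), pairList q = L := by
  have hlt (z : ZMod (r + 1)) : z.val < L.length := by
    rw [hL]
    exact ZMod.val_lt z
  refine ⟨(fun z => (L[z.val]'(hlt z)).1, fun z => (L[z.val]'(hlt z)).2), ?_⟩
  refine List.ext_getElem (by simp [pairList, hL]) fun t h1 h2 => ?_
  simp [pairList, Nat.mod_eq_of_lt (show t < r + 1 by omega)]

lemma sum_map_range {M : Type*} [AddCommMonoid M] (f : ℕ → M) (k : ℕ) :
    ((List.range k).map f).sum = ∑ t ∈ Finset.range k, f t := by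
  induction k with
  | zero => rfl
  | succ k ih => simp [List.range_succ, Finset.sum_range_succ, ih]

lemma sum_map_pairList {r : ℕ} (q : (ZMod (r + 1) → ℕ) × (ZMod (r + 1) → ℕ)) (g : ℕ × ℕ → ℤ) :
    ((pairList q).map g).sum = ∑ z, g (q.1 z, q.2 z) := by
  rw [pairList, List.map_map, sum_map_range, ← sum_range_natCast]
  rfl

lemma sum_take_map_pairList {r : ℕ} (q : (ZMod (r + 1) → ℕ) × (ZMod (r + 1) → ℕ))
    (g : ℕ × ℕ → ℤ) {j : ℕ} (hj : j < r + 1) :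
    (((pairList q).map g).take (j + 1)).sum =
      ∑ t ∈ Finset.range (j + 1), g (q.1 t, q.2 t) := by
  rw [pairList, List.map_map, ← List.map_take, List.take_range, min_eq_left (by omega),
    sum_map_range]
  rfl

lemma setOf_isDyck_eq_image {m n : ℤ} (hm : 0 < m) (hmn : 2 ≤ m * n) (r N M : ℕ)
    (hN : n = N + 1) (hM : m * n = M + 2) :
    {P : List Step | IsDyck m n 1 P ∧ ret m P = 0 ∧ (val P : ℤ) = r} =
      (fun q => blocks (pairList q) ++ [Step.E]) ''
        (↑(positivePairs m r N M) : Set ((ZMod (r + 1) → ℕ) × (ZMod (r + 1) → ℕ))) := by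
  have hlen (q : (ZMod (r + 1) → ℕ) × (ZMod (r + 1) → ℕ)) : (pairList q).length = r + 1 := by
    simp [pairList]
  have hval (L : List (ℕ × ℕ)) (hL : L ≠ []) :
      (val (blocks L ++ [Step.E]) : ℤ) = r ↔ L.length = r + 1 := by
    cases L with
    | nil => exact absurd rfl hL
    | cons p L => rw [val_blocks]; simp
  have hmem (q : (ZMod (r + 1) → ℕ) × (ZMod (r + 1) → ℕ)) : q ∈ positivePairs m r N M ↔
      ((pairList q).map fun p => (p.2 + 1 : ℤ)).sum + 1 = m * n ∧
      ((pairList q).map fun p => (p.1 + 1 : ℤ)).sum = n ∧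
      ∀ j < (pairList q).length, 1 ≤ (((pairList q).map (blockRise m)).take (j + 1)).sum := by
    have h3 : (∀ j < (pairList q).length,
          1 ≤ (((pairList q).map (blockRise m)).take (j + 1)).sum) ↔
        ∀ j < r + 1, 1 ≤ ∑ t ∈ Finset.range (j + 1), blockRise m (q.1 t, q.2 t) := by
      rw [hlen]
      exact forall₂_congr fun j hj => by rw [sum_take_map_pairList q _ hj]
    rw [positivePairs, Finset.mem_filter, Finset.mem_product, h3, sum_map_pairList,
      sum_map_pairList, mem_cyclicCompositions, mem_cyclicCompositions, hM, hN, ← and_assoc]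
    refine and_congr_left fun _ => ?_
    zify
    simp [Finset.sum_add_distrib]
    omega
  ext P
  simp only [Set.mem_ofPred_eq, Set.mem_image, Finset.mem_coe]
  rw [← and_assoc, isDyck_and_ret_eq_zero_iff hm hmn]
  constructor
  · rintro ⟨⟨L, hL, rfl, h⟩, hv⟩
    obtain ⟨q, rfl⟩ := exists_pairList ((hval L hL).1 hv)
    exact ⟨q, (hmem q).2 h, rfl⟩
  · rintro ⟨q, hq, rfl⟩
    have hne : pairList q ≠ [] := List.ne_nil_of_length_pos (by rw [hlen]; omega)
    exact ⟨⟨_, hne, rfl, (hmem q).1 hq⟩, (hval _ hne).2 (hlen q)⟩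

lemma ncard_setOf_isDyck {m n : ℤ} (hm : 0 < m) (hmn : 2 ≤ m * n) (r N M : ℕ)
    (hN : n = N + 1) (hM : m * n = M + 2) :
    (r + 1) * {P : List Step | IsDyck m n 1 P ∧ ret m P = 0 ∧ (val P : ℤ) = r}.ncard =
      N.choose r * M.choose r := by
  rw [setOf_isDyck_eq_image hm hmn r N M hN hM, Set.ncard_image_of_injective,
    Set.ncard_coe_finset, card_positivePairs]
  · rw [← hN]
    omega
  · exact fun q q' h => pairList_injective (blocks_injective (List.append_cancel_right h))

lemma setOf_isDyck_one_one :
    {P : List Step | IsDyck 1 1 1 P ∧ ret 1 P = 0 ∧ (val P : ℤ) = 0} = {[Step.N, Step.E]} := by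
  ext P
  simp only [Set.mem_ofPred_eq, Set.mem_singleton_iff]
  constructor
  · rintro ⟨⟨⟨⟨R, rfl⟩, hend, -⟩, hD⟩, -⟩
    rw [pt, List.take_length] at hend
    have hnn (Q : List Step) : 0 ≤ (Q.map stepVec).sum.1 ∧ 0 ≤ (Q.map stepVec).sum.2 := by
      induction Q with
      | nil => simp
      | cons s Q ih => cases s <;> simp [stepVec] <;> omega
    have hend1 := congrArg Prod.fst hend
    have hend2 := congrArg Prod.snd hend
    rcases R with _ | ⟨s, _ | ⟨s', R⟩⟩
    · simp [stepVec] at hend1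
    · cases s <;> simp_all [stepVec]
    · have := hnn R
      cases s <;> cases s' <;> simp [stepVec] at hend1 hend2 <;> omega
  · rintro rfl
    have h := (aboveLine_and_ret_eq_zero_iff 1 [Step.N, Step.E]).2
      (by simp [StaysAbove, rise, stepVec])
    exact ⟨⟨⟨by simp [StartsNorth], by simp [pt, stepVec], h.1⟩, by simp⟩, h.2, by decide⟩

/-- the number of `(m,1)`-Dyck paths of height `n` without returns and with
`r` valleys. -/
theorem statement13 (m n r : ℤ) (hm : 0 < m) (hn : 0 < n) (hr0 : 0 ≤ r) (hr : r ≤ n - 1) :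
    n * (({P : List Step | IsDyck m n 1 P ∧ ret m P = 0 ∧ (val P : ℤ) = r}.ncard : ℤ))
      = C n (r + 1) * C (m * n - 2) r := by
  obtain ⟨N, hN⟩ : ∃ N : ℕ, n = N + 1 := ⟨(n - 1).toNat, by omega⟩
  obtain ⟨k, rfl⟩ := Int.eq_ofNat_of_zero_le hr0
  rcases lt_or_ge (m * n) 2 with h | h
  · obtain rfl : m = 1 := by nlinarith
    obtain rfl : n = 1 := by omega
    obtain rfl : k = 0 := by omega
    rw [Nat.cast_zero, setOf_isDyck_one_one]
    simp [C]
  · obtain ⟨M, hM⟩ : ∃ M : ℕ, m * n = M + 2 := ⟨(m * n - 2).toNat, by omega⟩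
    have key := ncard_setOf_isDyck hm h k N M hN hM
    have hC (a b : ℕ) : C a b = (a.choose b : ℤ) := by
      simp [C]
    have hchoose := Nat.add_one_mul_choose_eq N k
    rw [hM, show (M + 2 - 2 : ℤ) = M by ring, hC M k, hN,
      show ((N : ℤ) + 1) = ((N + 1 : ℕ) : ℤ) by push_cast; rfl,
      show ((k : ℤ) + 1) = ((k + 1 : ℕ) : ℤ) by push_cast; rfl, hC]
    rw [hN, show ((N : ℤ) + 1) = ((N + 1 : ℕ) : ℤ) by push_cast; rfl] at key
    norm_cast at key ⊢
    refine Nat.eq_of_mul_eq_mul_left (Nat.succ_pos k) ?_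
    rw [Nat.succ_eq_add_one, mul_left_comm, key, ← mul_assoc, hchoose]
    ring
end

section
/- For all integers m, n > 0 and every integer r with 0 ≤ r ≤ n−1, the number of paths P ∈ D⁺(m,n,1) with val(P,m) = r satisfies (n−1) · #{P ∈ D⁺(m,n,1) : val(P,m) = r} = m·C(n−1, r)·C(mn−1, n−r−2), as an identity of integers. -/
/-! ### Completions of partial paths -/

/-- The number of valleys at an `x`-coordinate divisible by `m` of a path `w` that is preceded by the
step `c`, counted including a valley at the start of `w`. The `x`-coordinate is measured backwards
from a multiple of `m` that lies `e` units to the right of the start of `w`. -/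
def divValleys (m : ℕ) (e : ℤ) (c : Step) (w : List Step) : ℕ :=
  ∑ j ∈ Finset.range w.length,
    if (c :: w)[j]? = some Step.E ∧ w[j]? = some Step.N ∧ (m : ℤ) ∣ e - (pt w j).1 then 1 else 0

/-- `w` completes a Dyck path without returns: before `w` the last step was `c`, and
`e` east and `k` north steps remain; `w` contains `r` valleys at multiples of `m`. -/
structure IsCompletion (m : ℕ) (e k : ℤ) (c : Step) (r : ℕ) (w : List Step) : Prop where
  finish : pt w w.length = (e, k)
  above : ∀ j, m * (k - (pt w j).2) ≤ e - (pt w j).1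
  no_diag : ∀ s ∈ w, s ≠ Step.D
  no_return : ∀ j : ℕ, (c :: w)[j]? = some Step.E → w[j]? = some Step.N →
    e - (pt w j).1 ≠ m * (k - (pt w j).2)
  count : divValleys m e c w = r

/-- The set of completions. -/
def completions (m : ℕ) (e k : ℤ) (c : Step) (r : ℕ) : Set (List Step) :=
  {w | IsCompletion m e k c r w}

lemma pt_zero (w : List Step) : pt w 0 = 0 := by simp [pt]

lemma pt_cons_succ (s : Step) (w : List Step) (j : ℕ) :
    pt (s :: w) (j + 1) = stepVec s + pt w j := by simp [pt]

lemma pt_nil (j : ℕ) : pt [] j = 0 := by simp [pt]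

lemma pt_nonneg (w : List Step) (j : ℕ) : 0 ≤ (pt w j).1 ∧ 0 ≤ (pt w j).2 := by
  induction w generalizing j with
  | nil => simp [pt_nil]
  | cons s w ih =>
    cases j with
    | zero => simp [pt_zero]
    | succ j =>
      have := ih j
      rw [pt_cons_succ]
      cases s <;> simp [stepVec] <;> omega

lemma divValleys_cons (m : ℕ) (e : ℤ) (c s : Step) (w : List Step) :
    divValleys m e c (s :: w) = divValleys m (e - (stepVec s).1) s w +
      if c = Step.E ∧ s = Step.N ∧ (m : ℤ) ∣ e then 1 else 0 := by
  unfold divValleys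
  rw [List.length_cons, Finset.sum_range_succ']
  simp [pt_cons_succ, pt_zero, sub_sub]

lemma nil_mem_completions (m : ℕ) (e k : ℤ) (c : Step) (r : ℕ) :
    [] ∈ completions m e k c r ↔ e = 0 ∧ k = 0 ∧ r = 0 := by
  constructor
  · rintro ⟨h1, -, -, -, h5⟩
    simp [pt_nil, divValleys, Prod.ext_iff] at h1 h5
    omega
  · rintro ⟨rfl, rfl, rfl⟩
    constructor <;> simp [pt_nil, divValleys, Prod.ext_iff]

lemma cons_mem_completions (m : ℕ) (e k : ℤ) (c s : Step) (r : ℕ) (w : List Step) :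
    s :: w ∈ completions m e k c r ↔ s ≠ Step.D ∧ m * k ≤ e ∧
      (c = Step.E → s = Step.N → e ≠ m * k) ∧
      ∃ r', r = r' + (if c = Step.E ∧ s = Step.N ∧ (m : ℤ) ∣ e then 1 else 0) ∧
        w ∈ completions m (e - (stepVec s).1) (k - (stepVec s).2) s r' := by
  constructor
  · rintro ⟨h1, h2, h3, h4, h5⟩
    refine ⟨h3 s (by simp), by simpa [pt_zero] using h2 0, ?_, _, ?_, ?_, ?_, ?_, ?_, rfl⟩
    · intro hc hs
      simpa [pt_zero] using h4 0 (by simp [hc]) (by simp [hs])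
    · rw [← h5, divValleys_cons]
    · rw [List.length_cons, pt_cons_succ] at h1
      rw [eq_sub_of_add_eq' h1]; rfl
    · intro j
      simpa [pt_cons_succ, sub_sub] using h2 (j + 1)
    · exact fun t ht => h3 t (by simp [ht])
    · intro j hj hj'
      simpa [pt_cons_succ, sub_sub] using h4 (j + 1) (by simpa using hj) (by simpa using hj')
  · rintro ⟨h1, h2, h3, r', h4, h5⟩
    obtain ⟨g1, g2, g3, g4, g5⟩ := h5
    refine ⟨?_, ?_, ?_, ?_, ?_⟩
    · rw [List.length_cons, pt_cons_succ, g1]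
      simp [Prod.ext_iff]
    · rintro (_ | j)
      · simpa [pt_zero] using h2
      · simpa [pt_cons_succ, sub_sub] using g2 j
    · simpa [h1] using g3
    · rintro (_ | j) hj hj'
      · simpa [pt_zero] using h3 (by simpa using hj) (by simpa using hj')
      · simpa [pt_cons_succ, sub_sub] using g4 j (by simpa using hj) (by simpa using hj')
    · rw [divValleys_cons, g5, h4]

lemma completions_eq_empty (m : ℕ) (e k : ℤ) (c : Step) (r : ℕ) (h : k < 0 ∨ e < m * k) :
    completions m e k c r = ∅ := by
  refine Set.eq_empty_of_forall_notMem fun w hw => ?_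
  have h1 := hw.above 0
  have h2 := pt_nonneg w w.length
  rw [hw.finish] at h2
  simp only [pt_zero, Prod.fst_zero, Prod.snd_zero, sub_zero] at h1 h2
  omega

lemma completions_zero (m : ℕ) (c : Step) (r : ℕ) :
    completions m 0 0 c r = if r = 0 then {[]} else ∅ := by
  ext w
  cases w with
  | nil => rw [nil_mem_completions]; split_ifs <;> simp_all
  | cons s w =>
    have h : s :: w ∉ completions m 0 0 c r := by
      rw [cons_mem_completions]
      rintro ⟨hs, -, -, r', -, hw⟩
      rw [completions_eq_empty] at hw
      · exact hw
      · cases s <;> simp_all [stepVec]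
    split_ifs <;> simp [h]

/-- Decomposition of the set of completions by the first step. -/
lemma completions_eq_union (m : ℕ) (e k : ℤ) (c : Step) (r : ℕ) (he : 0 < e) (hk : m * k ≤ e) :
    completions m e k c r =
      {w | ∃ v, w = Step.N :: v ∧ (c = Step.E → e ≠ m * k) ∧
        ∃ r', r = r' + (if c = Step.E ∧ (m : ℤ) ∣ e then 1 else 0) ∧
          v ∈ completions m e (k - 1) Step.N r'} ∪
      List.cons Step.E '' completions m (e - 1) k Step.E r := by
  ext w
  cases w with
  | nil => simp [nil_mem_completions]; omega
  | cons s w =>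
    rw [cons_mem_completions]
    cases s <;> simp [stepVec, hk]

/-- A finite set of completions with a given number of elements. -/
def CompletionCard (m : ℕ) (e k : ℤ) (c : Step) (r : ℕ) (a : ℤ) : Prop :=
  (completions m e k c r).Finite ∧ ((completions m e k c r).ncard : ℤ) = a

lemma completionCard_of_eq_union {m : ℕ} {e k : ℤ} {c : Step} {r : ℕ} {a b : ℤ}
    {S T : Set (List Step)}
    (h : completions m e k c r = List.cons Step.N '' S ∪ List.cons Step.E '' T)
    (hS : S.Finite ∧ (S.ncard : ℤ) = a) (hT : T.Finite ∧ (T.ncard : ℤ) = b) :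
    CompletionCard m e k c r (a + b) := by
  have hd : Disjoint (List.cons Step.N '' S) (List.cons Step.E '' T) := by
    rw [Set.disjoint_left]
    rintro _ ⟨v, -, rfl⟩ ⟨u, -, hu⟩
    simp at hu
  refine ⟨?_, ?_⟩
  · rw [h]
    exact (hS.1.image _).union (hT.1.image _)
  · rw [h, Set.ncard_union_eq hd (hS.1.image _) (hT.1.image _),
      Set.ncard_image_of_injective _ List.cons_injective,
      Set.ncard_image_of_injective _ List.cons_injective]
    push_cast
    rw [hS.2, hT.2]

/-- The recursion for the number of completions after a north step. -/
lemma completionCard_north {m : ℕ} {e k : ℤ} {r : ℕ} {a b : ℤ} (he : 0 < e) (hk : m * k ≤ e)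
    (hN : CompletionCard m e (k - 1) Step.N r a) (hE : CompletionCard m (e - 1) k Step.E r b) :
    CompletionCard m e k Step.N r (a + b) := by
  refine completionCard_of_eq_union ?_ hN hE
  rw [completions_eq_union m e k _ r he hk]
  congr 1
  ext w
  simp [eq_comm, and_comm]

/-- The recursion for the number of completions after an east step to a column that is not
divisible by `m`. -/
lemma completionCard_east_of_not_dvd {m : ℕ} {e k : ℤ} {r : ℕ} {a b : ℤ} (he : 0 < e)
    (hk : m * k < e) (hd : ¬ (m : ℤ) ∣ e)
    (hN : CompletionCard m e (k - 1) Step.N r a) (hE : CompletionCard m (e - 1) k Step.E r b) :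
    CompletionCard m e k Step.E r (a + b) := by
  refine completionCard_of_eq_union ?_ hN hE
  rw [completions_eq_union m e k _ r he hk.le]
  congr 1
  ext w
  simp [hd, hk.ne', eq_comm, and_comm]

/-- The recursion for the number of completions without `m`-valleys after an east step to a column
divisible by `m`. -/
lemma completionCard_east_zero_of_dvd {m : ℕ} {e k : ℤ} {b : ℤ} (he : 0 < e)
    (hk : m * k < e) (hd : (m : ℤ) ∣ e) (hE : CompletionCard m (e - 1) k Step.E 0 b) :
    CompletionCard m e k Step.E 0 b := by
  rw [← zero_add b]
  refine completionCard_of_eq_union (S := ∅) ?_ (by simp) hE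
  rw [completions_eq_union m e k _ 0 he hk.le]
  congr 1
  ext w
  simp [hd]

/-- The recursion for the number of completions with an `m`-valley after an east step to a column
divisible by `m`. -/
lemma completionCard_east_succ_of_dvd {m : ℕ} {e k : ℤ} {r : ℕ} {a b : ℤ} (he : 0 < e)
    (hk : m * k < e) (hd : (m : ℤ) ∣ e)
    (hN : CompletionCard m e (k - 1) Step.N r a)
    (hE : CompletionCard m (e - 1) k Step.E (r + 1) b) :
    CompletionCard m e k Step.E (r + 1) (a + b) := by
  refine completionCard_of_eq_union ?_ hN hE
  rw [completions_eq_union m e k _ _ he hk.le]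
  congr 1
  ext w
  simp [hd, hk.ne', eq_comm, and_comm]

lemma completionCard_of_lt {m : ℕ} {e k : ℤ} {c : Step} {r : ℕ} (h : k < 0 ∨ e < m * k) :
    CompletionCard m e k c r 0 := by
  simp [CompletionCard, completions_eq_empty m e k c r h]

lemma completionCard_zero (m : ℕ) (c : Step) (r : ℕ) :
    CompletionCard m 0 0 c r (if r = 0 then 1 else 0) := by
  unfold CompletionCard
  rw [completions_zero]
  split_ifs <;> simp

lemma completionCard_east_of_eq {m : ℕ} {e k : ℤ} {r : ℕ} (he : 0 < e) (hk : m * k = e) :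
    CompletionCard m e k Step.E r 0 := by
  have h : completions m e k Step.E r = ∅ := by
    rw [completions_eq_union m e k _ r he hk.le, completions_eq_empty m (e - 1) k _ _ (by omega)]
    ext w
    simp [hk]
  simp [CompletionCard, h]

/-! ### Generating functions -/

section GeneratingFunctions

open scoped Polynomial PowerSeries

/-- The geometric series `1 / (1 - X)`. -/
noncomputable def geomSeries : ℤ[X]⟦X⟧ := PowerSeries.mk 1

/-- The series `1 - X + y X`, where `y` marks the `m`-valleys. -/
noncomputable def markSeries : ℤ[X]⟦X⟧ :=
  1 - PowerSeries.X + PowerSeries.C Polynomial.X * PowerSeries.X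

/-- The generating function of a block of `m` columns. -/
noncomputable def blockSeries (m : ℕ) : ℤ[X]⟦X⟧ := markSeries * geomSeries ^ m

/-- The series whose coefficients count completions consisting of `q` blocks. -/
noncomputable def blockCount (m : ℕ) : ℕ → ℤ[X]⟦X⟧
  | 0 => 1
  | q + 1 => blockSeries m ^ q *
      (blockSeries m - PowerSeries.X * PowerSeries.derivative ℤ[X] (blockSeries m))

/-- The series whose coefficients count completions with `e` columns remaining. -/
noncomputable def eastCount (m e : ℕ) : ℤ[X]⟦X⟧ := geomSeries ^ (e % m) * blockCount m (e / m)

lemma geomSeries_mul : geomSeries * (1 - PowerSeries.X) = 1 :=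
  PowerSeries.mk_one_mul_one_sub_eq_one _

lemma derivative_geomSeries : PowerSeries.derivative ℤ[X] geomSeries = geomSeries ^ 2 := by
  have h := congrArg (PowerSeries.derivative ℤ[X]) geomSeries_mul
  simp only [Derivation.leibniz, map_sub, PowerSeries.derivative_X, smul_eq_mul,
    Derivation.map_one_eq_zero] at h
  linear_combination geomSeries * h -
    PowerSeries.derivative ℤ[X] geomSeries * geomSeries_mul

lemma succ_mul_blockCount (m q : ℕ) :
    ((q : ℤ[X]⟦X⟧) + 1) * blockCount m (q + 1) =
      ((q : ℤ[X]⟦X⟧) + 1) * blockSeries m ^ (q + 1) -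
        PowerSeries.X * PowerSeries.derivative ℤ[X] (blockSeries m ^ (q + 1)) := by
  rw [PowerSeries.derivative_pow, blockCount, Nat.add_sub_cancel]
  push_cast
  ring

lemma coeff_X_mul_derivative (F : ℤ[X]⟦X⟧) (N : ℕ) :
    PowerSeries.coeff N (PowerSeries.X * PowerSeries.derivative ℤ[X] F) =
      N * PowerSeries.coeff N F := by
  cases N with
  | zero => simp
  | succ N =>
    rw [PowerSeries.coeff_succ_X_mul, PowerSeries.coeff_derivative]
    push_cast
    ring

lemma coeff_natCast_mul (F : ℤ[X]⟦X⟧) (a N : ℕ) :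
    PowerSeries.coeff N ((a : ℤ[X]⟦X⟧) * F) = a * PowerSeries.coeff N F := by
  rw [← nsmul_eq_mul, map_nsmul, nsmul_eq_mul]

lemma coeff_self_blockCount (m q : ℕ) : PowerSeries.coeff (q + 1) (blockCount m (q + 1)) = 0 := by
  have h := congrArg (PowerSeries.coeff (q + 1)) (succ_mul_blockCount m q)
  have h1 := coeff_natCast_mul (blockCount m (q + 1)) (q + 1) (q + 1)
  have h2 := coeff_natCast_mul (blockSeries m ^ (q + 1)) (q + 1) (q + 1)
  push_cast at h1 h2
  rw [map_sub, coeff_X_mul_derivative, h1, h2] at h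
  push_cast at h
  rw [sub_self] at h
  have h3 : ((q : ℤ[X]) + 1) ≠ 0 := by exact_mod_cast Nat.succ_ne_zero q
  exact (mul_eq_zero.mp h).resolve_left h3

lemma coeff_blockCount_succ (m q k : ℕ) (hk : k ≤ q) :
    PowerSeries.coeff k (blockCount m (q + 1)) =
      PowerSeries.coeff k (blockSeries m * blockCount m q) := by
  cases q with
  | zero =>
    obtain rfl : k = 0 := by omega
    simp [blockCount]
  | succ q =>
    have h : blockCount m (q + 2) = blockSeries m * blockCount m (q + 1) := by
      rw [blockCount, blockCount, pow_succ', mul_assoc]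
    rw [h]

lemma eastCount_succ_of_not_dvd (m e : ℕ) (hd : ¬ m ∣ e + 1) :
    eastCount m (e + 1) = geomSeries * eastCount m e := by
  have h1 : (e + 1) / m = e / m := by rw [Nat.succ_div, if_neg hd, add_zero]
  have h2 : (e + 1) % m = e % m + 1 := by
    have := Nat.div_add_mod (e + 1) m
    have := Nat.div_add_mod e m
    rw [h1] at *
    omega
  rw [eastCount, h1, h2, eastCount]
  ring

lemma coeff_eastCount_succ_of_dvd (m e k : ℕ) (hm : 0 < m) (hd : m ∣ e + 1) (hk : m * k < e + 1) :
    PowerSeries.coeff k (eastCount m (e + 1)) =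
      PowerSeries.coeff k (markSeries * geomSeries * eastCount m e) := by
  have h1 : (e + 1) / m = e / m + 1 := by rw [Nat.succ_div, if_pos hd]
  have h3 : (e + 1) % m = 0 := Nat.mod_eq_zero_of_dvd hd
  have h2 : e % m + 1 = m := by
    have := Nat.div_add_mod (e + 1) m
    have := Nat.div_add_mod e m
    rw [h1, mul_add] at *
    omega
  have h4 : k ≤ e / m := by
    rw [Nat.le_div_iff_mul_le hm, mul_comm]
    omega
  rw [eastCount, h1, h3, pow_zero, one_mul, coeff_blockCount_succ m _ k h4, eastCount, blockSeries]
  have h5 : geomSeries ^ m = geomSeries * geomSeries ^ (e % m) := by rw [← pow_succ', h2]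
  rw [h5]
  simp only [mul_assoc]

lemma coeff_eastCount_mul_self (m k : ℕ) (hm : 0 < m) (hk : 0 < k) :
    PowerSeries.coeff k (eastCount m (m * k)) = 0 := by
  obtain ⟨q, rfl⟩ := Nat.exists_eq_succ_of_ne_zero hk.ne'
  rw [eastCount, Nat.mul_mod_right, Nat.mul_div_cancel_left _ hm, pow_zero, one_mul]
  exact coeff_self_blockCount m q

lemma eastCount_zero (m : ℕ) : eastCount m 0 = 1 := by
  simp [eastCount, blockCount]

/-- The number of completions after a north step, given the numbers after an east step. -/
lemma completionCard_north_of_east {m e : ℕ}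
    (hE : ∀ k r : ℕ, m * k ≤ e → CompletionCard m e k Step.E r
      ((PowerSeries.coeff k (eastCount m e)).coeff r)) (k r : ℕ) (hk : m * k < e + 1) :
    CompletionCard m (e + 1 : ℕ) k Step.N r
      ((PowerSeries.coeff k (geomSeries * eastCount m e)).coeff r) := by
  have hg : geomSeries * eastCount m e =
      PowerSeries.X * (geomSeries * eastCount m e) + eastCount m e := by
    linear_combination eastCount m e * geomSeries_mul
  rw [hg, map_add, Polynomial.coeff_add]
  have he : CompletionCard m ((e + 1 : ℕ) - 1) k Step.E r
      ((PowerSeries.coeff k (eastCount m e)).coeff r) := by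
    simpa using hE k r (by omega)
  refine completionCard_north (by omega) (by exact_mod_cast hk.le) ?_ he
  induction k with
  | zero => simpa using completionCard_of_lt (by simp)
  | succ k ih =>
    rw [PowerSeries.coeff_succ_X_mul]
    have hk' : m * k < e + 1 := by rw [mul_add] at hk; omega
    have he' : CompletionCard m ((e + 1 : ℕ) - 1) k Step.E r
        ((PowerSeries.coeff k (eastCount m e)).coeff r) := by
      simpa using hE k r (by omega)
    rw [hg, map_add, Polynomial.coeff_add]
    have := completionCard_north (by omega) (by exact_mod_cast hk'.le) (ih hk' he') he'
    simpa using this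

/-- The number of completions after an east step. -/
lemma completionCard_east {m : ℕ} (hm : 0 < m) (e k r : ℕ) (hk : m * k ≤ e) :
    CompletionCard m e k Step.E r ((PowerSeries.coeff k (eastCount m e)).coeff r) := by
  induction e generalizing k r with
  | zero =>
    obtain rfl : k = 0 := by
      rcases Nat.mul_eq_zero.mp (Nat.le_zero.mp hk) with h | h <;> omega
    simpa [eastCount_zero, Polynomial.coeff_one] using completionCard_zero m Step.E r
  | succ e ih =>
    rcases hk.eq_or_lt with hk | hk
    · have h0 : 0 < k := Nat.pos_of_ne_zero (by rintro rfl; simp at hk)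
      rw [← hk, coeff_eastCount_mul_self m k hm h0, Polynomial.coeff_zero, hk]
      exact completionCard_east_of_eq (by omega) (by exact_mod_cast hk)
    have hN : ∀ r, CompletionCard m (e + 1 : ℕ) (k - 1) Step.N r
        ((PowerSeries.coeff k (PowerSeries.X * (geomSeries * eastCount m e))).coeff r) := by
      intro r
      cases k with
      | zero => simpa using completionCard_of_lt (by simp)
      | succ k =>
        rw [PowerSeries.coeff_succ_X_mul]
        have := completionCard_north_of_east ih k r (by rw [mul_add] at hk; omega)
        simpa using this
    have hE : ∀ r, CompletionCard m ((e + 1 : ℕ) - 1) k Step.E r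
        ((PowerSeries.coeff k (eastCount m e)).coeff r) := by
      intro r
      simpa using ih k r (by omega)
    have hk' : (m : ℤ) * k < (e + 1 : ℕ) := by exact_mod_cast hk
    by_cases hd : m ∣ e + 1
    · have hd' : (m : ℤ) ∣ (e + 1 : ℕ) := by exact_mod_cast hd
      have hg : markSeries * geomSeries * eastCount m e = PowerSeries.C Polynomial.X *
          (PowerSeries.X * (geomSeries * eastCount m e)) + eastCount m e := by
        rw [markSeries]
        linear_combination eastCount m e * geomSeries_mul
      rw [coeff_eastCount_succ_of_dvd m e k hm hd hk, hg, map_add, Polynomial.coeff_add,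
        PowerSeries.coeff_C_mul]
      cases r with
      | zero =>
        simpa using completionCard_east_zero_of_dvd (by omega) hk' hd' (hE 0)
      | succ r =>
        rw [Polynomial.coeff_X_mul]
        exact completionCard_east_succ_of_dvd (by omega) hk' hd' (hN r) (hE (r + 1))
    · have hg : geomSeries * eastCount m e =
          PowerSeries.X * (geomSeries * eastCount m e) + eastCount m e := by
        linear_combination eastCount m e * geomSeries_mul
      rw [eastCount_succ_of_not_dvd m e hd, hg, map_add, Polynomial.coeff_add]
      exact completionCard_east_of_not_dvd (by omega) hk'
        (by exact_mod_cast hd) (hN r) (hE r)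

/-- The number of completions from the start of a path of height `N + 1`. -/
lemma completionCard_start {m : ℕ} (hm : 0 < m) (N r : ℕ) :
    CompletionCard m (m * (N + 1) : ℕ) (N + 1 : ℕ) Step.N r
      ((PowerSeries.coeff N (geomSeries ^ m * blockCount m N)).coeff r) := by
  obtain ⟨e, he⟩ : ∃ e, m * (N + 1) = e + 1 :=
    Nat.exists_eq_succ_of_ne_zero (Nat.mul_pos hm N.succ_pos).ne'
  have h1 := completionCard_north_of_east (fun k r hk => completionCard_east hm e k r hk) N r
    (by rw [← he, mul_add]; omega)
  have h2 : e = m * N + (m - 1) := by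
    rw [mul_add] at he
    omega
  have h3 : geomSeries * eastCount m e = geomSeries ^ m * blockCount m N := by
    rw [eastCount, h2, Nat.mul_add_div hm, Nat.mul_add_mod, Nat.mod_eq_of_lt (by omega),
      Nat.div_eq_of_lt (by omega), add_zero, ← mul_assoc, ← pow_succ', Nat.sub_add_cancel hm]
  rw [h3] at h1
  rw [← add_zero (Polynomial.coeff _ _), he]
  refine completionCard_north (by omega) (by exact_mod_cast he.le) (by simpa using h1) ?_
  refine completionCard_of_lt (Or.inr ?_)
  have : (m : ℤ) * (N + 1 : ℕ) = (e + 1 : ℕ) := by exact_mod_cast he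
  rw [this]
  omega

lemma mul_coeff_geomSeries_pow_mul_blockCount (m N : ℕ) :
    ((N + 1 : ℕ) : ℤ[X]) *
      PowerSeries.coeff (N + 1) (geomSeries ^ m * blockCount m (N + 1)) =
      m * PowerSeries.coeff N (geomSeries ^ (m + 1) * blockSeries m ^ (N + 1)) := by
  have hd : PowerSeries.derivative ℤ[X] (geomSeries ^ m) = m * geomSeries ^ (m + 1) := by
    rw [PowerSeries.derivative_pow, derivative_geomSeries]
    cases m with
    | zero => simp
    | succ m => simp only [Nat.add_sub_cancel]; ring
  have h := coeff_X_mul_derivative (geomSeries ^ m * blockSeries m ^ (N + 1)) (N + 1)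
  have hl : PowerSeries.derivative ℤ[X] (geomSeries ^ m * blockSeries m ^ (N + 1)) =
      geomSeries ^ m * PowerSeries.derivative ℤ[X] (blockSeries m ^ (N + 1)) +
        blockSeries m ^ (N + 1) * PowerSeries.derivative ℤ[X] (geomSeries ^ m) := by
    simp only [Derivation.leibniz, smul_eq_mul]
  rw [hl, hd] at h
  rw [← coeff_natCast_mul _ (N + 1)] at h ⊢
  rw [← coeff_natCast_mul _ m, ← PowerSeries.coeff_succ_X_mul N]
  have h1 : ((N + 1 : ℕ) : ℤ[X]⟦X⟧) * (geomSeries ^ m * blockCount m (N + 1)) =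
      ((N + 1 : ℕ) : ℤ[X]⟦X⟧) * (geomSeries ^ m * blockSeries m ^ (N + 1)) -
      PowerSeries.X * (geomSeries ^ m * PowerSeries.derivative ℤ[X] (blockSeries m ^ (N + 1))) := by
    have := succ_mul_blockCount m N
    push_cast
    linear_combination geomSeries ^ m * this
  rw [h1, map_sub, ← h, ← map_sub]
  congr 1
  ring

lemma coeff_geomSeries_pow (d k : ℕ) :
    PowerSeries.coeff k (geomSeries ^ (d + 1)) = ((d + k).choose d : ℤ[X]) := by
  rw [geomSeries, PowerSeries.mk_one_pow_eq_mk_choose_add, PowerSeries.coeff_mk]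

lemma coeff_coeff_geomSeries_pow_mul_blockSeries_pow {m N r : ℕ} (hm : 0 < m) (hr : r ≤ N + 1) :
    (PowerSeries.coeff N (geomSeries ^ (m + 1) * blockSeries m ^ (N + 1))).coeff r =
      (N + 1).choose r * (if r ≤ N then ((m * (N + 2) - 1).choose (N - r) : ℤ) else 0) := by
  have hexp : geomSeries ^ (m + 1) * blockSeries m ^ (N + 1) =
      ∑ i ∈ Finset.range (N + 2), PowerSeries.C (Polynomial.monomial i ((N + 1).choose i : ℤ)) *
        (PowerSeries.X ^ i * geomSeries ^ (m + m * (N + 1) - (N + 1) + i + 1)) := by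
    rw [blockSeries, mul_pow, markSeries, add_comm (1 - _), add_pow, Finset.sum_mul, Finset.mul_sum]
    refine Finset.sum_congr rfl fun i hi => ?_
    have hi' : i ≤ N + 1 := by simpa [Nat.lt_succ_iff] using hi
    have hle : N + 1 ≤ m * (N + 1) := Nat.le_mul_of_pos_left _ hm
    have h1 : geomSeries ^ (m + 1) * (geomSeries ^ m) ^ (N + 1) =
        geomSeries ^ (N + 1 - i) * geomSeries ^ (m + m * (N + 1) - (N + 1) + i + 1) := by
      rw [← pow_mul, ← pow_add, ← pow_add]
      congr 1
      omega
    have h2 : geomSeries ^ (N + 1 - i) * (1 - PowerSeries.X) ^ (N + 1 - i) = 1 := by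
      rw [← mul_pow, geomSeries_mul, one_pow]
    have h3 : PowerSeries.C (Polynomial.monomial i ((N + 1).choose i : ℤ)) =
        (PowerSeries.C (Polynomial.X : ℤ[X])) ^ i * ((N + 1).choose i : ℤ[X]⟦X⟧) := by
      rw [← map_pow, ← map_natCast (PowerSeries.C : ℤ[X] →+* _), ← map_mul,
        ← Polynomial.C_mul_X_pow_eq_monomial]
      simp [mul_comm]
    rw [h3, mul_pow]
    linear_combination (PowerSeries.C (Polynomial.X : ℤ[X]) ^ i * PowerSeries.X ^ i *
      (1 - PowerSeries.X) ^ (N + 1 - i) * ((N + 1).choose i : ℤ[X]⟦X⟧)) * h1 +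
      (PowerSeries.C (Polynomial.X : ℤ[X]) ^ i * PowerSeries.X ^ i * ((N + 1).choose i : ℤ[X]⟦X⟧) *
      geomSeries ^ (m + m * (N + 1) - (N + 1) + i + 1)) * h2
  have hterm : ∀ i, (PowerSeries.coeff N
      (PowerSeries.C (Polynomial.monomial i ((N + 1).choose i : ℤ)) *
        (PowerSeries.X ^ i * geomSeries ^ (m + m * (N + 1) - (N + 1) + i + 1)))).coeff r =
      if i = r then (N + 1).choose r *
        (if r ≤ N then ((m * (N + 2) - 1).choose (N - r) : ℤ) else 0) else 0 := by
    intro i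
    rw [PowerSeries.coeff_C_mul, PowerSeries.coeff_X_pow_mul']
    by_cases hi : i ≤ N
    · rw [if_pos hi, coeff_geomSeries_pow, ← Polynomial.C_eq_natCast, Polynomial.coeff_mul_C,
        Polynomial.coeff_monomial]
      split_ifs with h1 h2
      · subst h1
        have hle : N + 1 ≤ m * (N + 1) := Nat.le_mul_of_pos_left _ hm
        have h3 : m + m * (N + 1) - (N + 1) + i + (N - i) = m * (N + 2) - 1 := by
          have : m * (N + 2) = m + m * (N + 1) := by ring
          omega
        rw [Nat.choose_symm_add, h3]
      · omega
      · simp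
    · rw [if_neg hi]
      split_ifs with h1 h2
      · omega
      · simp
      · simp
  rw [hexp, map_sum, Polynomial.finsetSum_coeff, Finset.sum_congr rfl fun i _ => hterm i,
    Finset.sum_ite_eq', if_pos (by simpa [Nat.lt_succ_iff] using hr)]

end GeneratingFunctions

/-! ### Dyck paths -/

lemma ival_eq_divValleys (m n : ℕ) (P : List Step) :
    ival m m P = divValleys m (m * n : ℕ) Step.N P := by
  let f : ℕ → ℕ := fun j => if (Step.N :: P)[j]? = some Step.E ∧ P[j]? = some Step.N ∧
    (m : ℤ) ∣ (m * n : ℕ) - (pt P j).1 then 1 else 0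
  have h1 : divValleys m (m * n : ℕ) Step.N P = ∑ j ∈ Finset.range (P.length + 1), f j := by
    rw [Finset.sum_range_succ]
    simp [divValleys, f]
  rw [h1, Finset.sum_range_succ', ival, valleys, Finset.filter_filter, Finset.card_filter]
  have h0 : f 0 = 0 := by simp [f]
  rw [h0, add_zero]
  refine Finset.sum_congr rfl fun j _ => ?_
  have h2 : (pt P (j + 1)).1 % m = m % m ↔ (m : ℤ) ∣ (m * n : ℕ) - (pt P (j + 1)).1 := by
    rw [Int.emod_self, ← Int.dvd_iff_emod_eq_zero]
    push_cast
    exact (dvd_sub_right (Dvd.intro _ rfl)).symm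
  simp only [f, h2, List.getElem?_cons_succ, and_assoc]

lemma ret_eq_zero_iff (m n : ℕ) (P : List Step) :
    ret m P = 0 ↔ ∀ j : ℕ, (Step.N :: P)[j]? = some Step.E → P[j]? = some Step.N →
      ((m * n : ℕ) : ℤ) - (pt P j).1 ≠ m * ((n : ℤ) - (pt P j).2) := by
  have h : ∀ x y : ℤ, ((m * n : ℕ) : ℤ) - x ≠ m * ((n : ℤ) - y) ↔ x ≠ m * y := by
    intro x y
    push_cast
    rw [mul_sub, not_iff_not]
    constructor <;> intro h <;> linarith
  simp only [h]
  rw [ret, returns, valleys, Finset.card_eq_zero, Finset.filter_eq_empty_iff]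
  constructor
  · rintro h (_ | j) h1 h2
    · simp at h1
    · rw [List.getElem?_cons_succ] at h1
      refine h (x := j) ?_
      have := (List.getElem?_eq_some_iff.mp h1).1
      exact Finset.mem_filter.2 ⟨Finset.mem_range.2 this, h1, h2⟩
  · intro h j hj
    simp only [Finset.mem_filter] at hj
    exact h (j + 1) (by simpa using hj.2.1) hj.2.2

lemma isDyck_iff (m n r : ℕ) (hn : 0 < n) (P : List Step) :
    (IsDyck m n 1 P ∧ ret m P = 0 ∧ (ival m m P : ℤ) = r) ↔
      P ∈ completions m (m * n : ℕ) n Step.N r := by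
  have h : ∀ x y : ℤ, m * ((n : ℤ) - y) ≤ (m * n : ℕ) - x ↔ x ≤ m * y := by
    intro x y
    push_cast
    rw [mul_sub]
    constructor <;> intro h <;> linarith
  rw [ret_eq_zero_iff m n, ival_eq_divValleys m n, Nat.cast_inj]
  constructor
  · rintro ⟨⟨⟨-, h2, h3⟩, h4⟩, h5, h6⟩
    exact ⟨by simpa using h2, fun j => (h _ _).2 (h3 j), h4, h5, h6⟩
  · rintro ⟨h2, h3, h4, h5, h6⟩
    have h3' : AboveLine m P := fun j => (h _ _).1 (h3 j)
    refine ⟨⟨⟨?_, by simpa using h2, h3'⟩, h4⟩, h5, h6⟩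
    cases P with
    | nil =>
      simp [pt_nil, Prod.ext_iff] at h2
      omega
    | cons s w =>
      have h7 := h3' 1
      have h8 := h4 s (by simp)
      rw [pt_cons_succ, pt_zero] at h7
      cases s <;> simp_all [StartsNorth, stepVec]

/-- the number of `(m,1)`-Dyck paths of height `n` without returns and with
`r` `m`-valleys. -/
theorem statement15 (m n r : ℤ) (hm : 0 < m) (hn : 0 < n) (hr0 : 0 ≤ r) (hr : r ≤ n - 1) :
    (n - 1) * (({P : List Step | IsDyck m n 1 P ∧ ret m P = 0 ∧
        (ival m m P : ℤ) = r}.ncard : ℤ))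
      = m * C (n - 1) r * C (m * n - 1) (n - r - 2) := by
  lift m to ℕ using hm.le
  lift n to ℕ using hn.le
  lift r to ℕ using hr0
  have hm' : 0 < m := by exact_mod_cast hm
  have hn' : 0 < n := by exact_mod_cast hn
  have hset : {P : List Step | IsDyck m n 1 P ∧ ret m P = 0 ∧ (ival m m P : ℤ) = r} =
      completions m (m * n : ℕ) n Step.N r := Set.ext (isDyck_iff m n r hn')
  rw [hset]
  obtain ⟨N, rfl⟩ : ∃ N, n = N + 1 := Nat.exists_eq_succ_of_ne_zero hn'.ne'
  rw [(completionCard_start hm' N r).2]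
  rcases N with _ | N
  · have : ((0 + 1 : ℕ) : ℤ) - r - 2 < 0 := by omega
    rw [C.eq_1 _ (((0 + 1 : ℕ) : ℤ) - r - 2), if_pos this]
    simp
  have hr' : r ≤ N + 1 := by omega
  have h := congrArg (fun p => Polynomial.coeff p r) (mul_coeff_geomSeries_pow_mul_blockCount m N)
  simp only [← Polynomial.C_eq_natCast, Polynomial.coeff_C_mul,
    coeff_coeff_geomSeries_pow_mul_blockSeries_pow hm' hr'] at h
  have hC1 : C (((N + 1 + 1 : ℕ) : ℤ) - 1) r = ((N + 1).choose r : ℤ) := by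
    have : ((N + 1 + 1 : ℕ) : ℤ) - 1 = (N + 1 : ℕ) := by push_cast; ring
    rw [this, C, if_neg (by omega), if_pos (by omega), Int.toNat_natCast, Int.toNat_natCast]
  have hC2 : C (m * ((N + 1 + 1 : ℕ) : ℤ) - 1) (((N + 1 + 1 : ℕ) : ℤ) - r - 2) =
      if r ≤ N then ((m * (N + 2) - 1).choose (N - r) : ℤ) else 0 := by
    have h1 : m * ((N + 1 + 1 : ℕ) : ℤ) - 1 = (m * (N + 2) - 1 : ℕ) := by
      rw [Nat.cast_sub (Nat.mul_pos hm' (by omega))]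
      push_cast
      ring
    rw [h1, C, if_pos (by omega : (0 : ℤ) ≤ (m * (N + 2) - 1 : ℕ)), Int.toNat_natCast]
    by_cases hrN : r ≤ N
    · rw [if_neg (by omega), if_pos hrN]
      congr 2
      omega
    · rw [if_pos (by omega), if_neg hrN]
  rw [hC1, hC2, mul_assoc]
  push_cast at h ⊢
  rw [add_sub_cancel_right]
  exact h
end
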